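/- arXiv:1110.6620 — 11 statements merged into one kernel-verified Lean document; each statement's English description precedes it below -/
import Mathlib

section
/- Let n be a positive integer and let C be the Cartan matrix of type A_n. Then the characteristic polynomial of C (over ℝ) factors as det(x·I - C) = ∏_{j=1}^{n} (x - 4·sin²(jπ/(2(n+1)))); in particular the eigenvalues of C are exactly the numbers 4·sin²(jπ/(2(n+1))) for j = 1, 2, …, n. -/
open Matrix Polynomial Real

/-- The Cartan matrix of type `A n`: `2` on the diagonal, `-1` on the sub- and
superdiagonal, `0` elsewhere. -/
def cartanA (n : ℕ) : Matrix (Fin n) (Fin n) ℤ :=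
  Matrix.of fun i j =>
    if (i : ℕ) = (j : ℕ) then 2
    else if (i : ℕ) + 1 = (j : ℕ) ∨ (j : ℕ) + 1 = (i : ℕ) then -1
    else 0

/-- The tridiagonal matrix with `a` on the diagonal and `1` on the sub- and superdiagonal. -/
def tridiagonal {R : Type*} [CommRing R] (a : R) (n : ℕ) : Matrix (Fin n) (Fin n) R :=
  Matrix.of fun i j =>
    if (i : ℕ) = (j : ℕ) then a
    else if (i : ℕ) + 1 = (j : ℕ) ∨ (j : ℕ) + 1 = (i : ℕ) then 1
    else 0

theorem tridiagonal_submatrix_succ {R : Type*} [CommRing R] (a : R) (n : ℕ) :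
    (tridiagonal a (n + 1)).submatrix Fin.succ Fin.succ = tridiagonal a n := by
  ext i j
  simp [tridiagonal]

theorem det_tridiagonal_add_two {R : Type*} [CommRing R] (a : R) (n : ℕ) :
    (tridiagonal a (n + 2)).det = a * (tridiagonal a (n + 1)).det - (tridiagonal a n).det := by
  have minor : ((tridiagonal a (n + 2)).submatrix Fin.succ (Fin.succAbove 1)).det =
      (tridiagonal a n).det := by
    rw [det_succ_column_zero, Fin.sum_univ_succ, Finset.sum_eq_zero]
    · have h : ((tridiagonal a (n + 2)).submatrix Fin.succ (Fin.succAbove 1)).submatrix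
          (Fin.succAbove 0) Fin.succ = tridiagonal a n := by
        ext i j
        have hj : (Fin.succAbove (1 : Fin (n + 2)) j.succ) = j.succ.succ :=
          Fin.succ_succAbove_succ 0 j
        simp [tridiagonal, hj]
      rw [h]
      simp [tridiagonal]
    · intro i _
      simp [tridiagonal]
  rw [det_succ_row_zero, Fin.sum_univ_succ, Fin.sum_univ_succ, Finset.sum_eq_zero]
  · have h := tridiagonal_submatrix_succ a (n + 1)
    have h1 : (Fin.succ 0 : Fin (n + 2)) = 1 := rfl
    rw [h1, minor, Fin.succAbove_zero, h]
    simp [tridiagonal]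
    ring
  · intro i _
    simp [tridiagonal]

theorem det_tridiagonal {R : Type*} [CommRing R] (a : R) :
    ∀ n : ℕ, (tridiagonal a n).det = (Chebyshev.S R n).eval a
  | 0 => by simp
  | 1 => by simp [tridiagonal]
  | n + 2 => by
    rw [det_tridiagonal_add_two, det_tridiagonal a (n + 1), det_tridiagonal a n]
    push_cast
    rw [Chebyshev.S_add_two]
    simp

theorem eval_charpoly_cartanA (n : ℕ) (x : ℝ) :
    ((cartanA n).map (Int.cast : ℤ → ℝ)).charpoly.eval x = (Chebyshev.S ℝ n).eval (x - 2) := by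
  rw [eval_charpoly, ← det_tridiagonal]
  congr 1
  ext i j
  by_cases hij : i = j
  · simp [tridiagonal, cartanA, hij]
  · simp only [tridiagonal, cartanA, Matrix.sub_apply, scalar_apply, diagonal_apply_ne _ hij, map_apply, of_apply,
      Fin.val_inj, hij, if_false]
    split_ifs <;> simp

theorem eval_charpoly_cartanA_mul_sin (n : ℕ) (θ : ℝ) :
    ((cartanA n).map (Int.cast : ℤ → ℝ)).charpoly.eval (2 + 2 * Real.cos θ) * Real.sin θ =
      Real.sin ((n + 1) * θ) := by
  have h := congrArg (eval (Real.cos θ)) (Chebyshev.S_comp_two_mul_X ℝ n)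
  rw [eval_comp] at h
  simp only [eval_mul, eval_ofNat, eval_X] at h
  rw [eval_charpoly_cartanA, add_sub_cancel_left, h, Chebyshev.U_real_cos]
  simp

theorem four_mul_sin_half_sq (θ : ℝ) : 4 * Real.sin (θ / 2) ^ 2 = 2 + 2 * Real.cos (π - θ) := by
  rw [Real.sin_sq_eq_half_sub, mul_div_cancel₀ θ two_ne_zero, Real.cos_pi_sub]
  ring

theorem charpoly_cartanA_factorization (n : ℕ) (hn : 0 < n) :
    ((cartanA n).map (Int.cast : ℤ → ℝ)).charpoly =
      ∏ j ∈ Finset.Icc 1 n,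
        (X - C (4 * Real.sin (j * Real.pi / (2 * (n + 1))) ^ 2)) := by
  have hn1 : (0 : ℝ) < n + 1 := by positivity
  have angle (j : ℕ) : 4 * Real.sin (j * π / (2 * (n + 1))) ^ 2 =
      2 + 2 * Real.cos (π - j * π / (n + 1)) := by
    rw [← four_mul_sin_half_sq, div_div, mul_comm (2 : ℝ)]
  have angle_mem (j : ℕ) (hj : j ∈ Finset.Icc 1 n) : π - j * π / (n + 1) ∈ Set.Ioo 0 π := by
    obtain ⟨h1, h2⟩ := Finset.mem_Icc.mp hj
    have hj_pos : (0 : ℝ) < j := by exact_mod_cast h1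
    have hj_lt : (j : ℝ) < n + 1 := by exact_mod_cast Nat.lt_succ_of_le h2
    have hlt : j * π / (n + 1) < π := by
      rw [div_lt_iff₀ hn1, mul_comm π]
      exact mul_lt_mul_of_pos_right hj_lt pi_pos
    have hpos : 0 < j * π / (n + 1) := by positivity
    constructor <;> linarith
  refine eq_of_monic_of_dvd_of_natDegree_le (monic_prod_X_sub_C _ _)
    (charpoly_monic _) ?_ ?_
  · refine Finset.prod_dvd_of_coprime ?_ ?_
    · intro i hi j hj hij
      refine isCoprime_X_sub_C_of_isUnit_sub (sub_ne_zero.mpr fun h => hij ?_).isUnit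
      rw [angle, angle] at h
      have hcos := Real.injOn_cos (Set.Ioo_subset_Icc_self (angle_mem i hi))
        (Set.Ioo_subset_Icc_self (angle_mem j hj)) (by linarith)
      have h3 : (i : ℝ) * π / (n + 1) = j * π / (n + 1) := by linarith
      field_simp at h3
      exact_mod_cast h3
    · intro j hj
      rw [dvd_iff_isRoot, IsRoot, angle]
      refine (mul_eq_zero.mp ?_).resolve_right (Real.sin_pos_of_mem_Ioo (angle_mem j hj)).ne'
      rw [eval_charpoly_cartanA_mul_sin]
      have h : (n + 1 : ℝ) * (π - j * π / (n + 1)) = ((n + 1 - j : ℤ) : ℝ) * π := by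
        push_cast
        field_simp
      rw [h, Real.sin_int_mul_pi]
  · rw [charpoly_natDegree_eq_dim, natDegree_finsetProd_X_sub_C_eq_card]
    simp
end

section
/- For every positive integer n, 2^{2n} · ∏_{j=1}^{n} sin²(jπ/(2(n+1))) = n + 1 (the A_n sine formula). -/
open Real

/-- The product of the lengths of the chords from one vertex of a regular `(n + 1)`-gon inscribed
in the unit circle to the other vertices is `n + 1`. -/
lemma prod_two_mul_sin_pi_div (n : ℕ) :
    ∏ k ∈ Finset.range n, (2 * sin ((k + 1 : ℕ) * π / (n + 1))) = n + 1 := by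
  have hprod := congrArg (‖·‖)
    (Complex.isPrimitiveRoot_exp (n + 1) n.succ_ne_zero).prod_one_sub_pow_eq_order
  have hcast : ‖((n : ℂ) + 1)‖ = n + 1 := by
    exact_mod_cast Complex.norm_natCast (n + 1)
  simp only [norm_prod, hcast] at hprod
  refine (Finset.prod_congr rfl fun k hk => ?_).trans hprod
  have hkn : ((k + 1 : ℕ) : ℝ) ≤ n + 1 := by
    exact_mod_cast Nat.succ_le_succ (Finset.mem_range.mp hk).le
  have hsin : 0 ≤ sin ((k + 1 : ℕ) * π / (n + 1)) := by
    refine sin_nonneg_of_nonneg_of_le_pi (by positivity) ?_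
    rw [div_le_iff₀ (by positivity), mul_comm]
    gcongr
  have hexp : Complex.exp (2 * π * Complex.I / (n + 1 : ℕ)) ^ (k + 1) =
      Complex.exp (Complex.I * (2 * ((k + 1 : ℕ) * π / (n + 1)) : ℝ)) := by
    rw [← Complex.exp_nat_mul]
    congr 1
    push_cast
    ring
  rw [hexp, norm_sub_rev, Complex.norm_exp_I_mul_ofReal_sub_one,
    mul_div_cancel_left₀ _ two_ne_zero, norm_of_nonneg (by positivity)]

theorem sine_formula_An (n : ℕ) (hn : 0 < n) :
    2 ^ (2 * n) * ∏ j ∈ Finset.Icc 1 n,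
      Real.sin (j * Real.pi / (2 * (n + 1))) ^ 2 = n + 1 := by
  set f : ℕ → ℝ := fun k => sin ((k + 1 : ℕ) * π / (2 * (n + 1))) with hf
  have hshift : ∏ j ∈ Finset.Icc 1 n, sin (j * π / (2 * (n + 1))) ^ 2 =
      ∏ k ∈ Finset.range n, f k ^ 2 := by
    rw [← Finset.Ico_add_one_right_eq_Icc, Finset.prod_Ico_eq_prod_range]
    simp [hf, add_comm]
  have hreflect : ∏ k ∈ Finset.range n, f k ^ 2 =
      ∏ k ∈ Finset.range n, f k * f (n - 1 - k) := by
    rw [Finset.prod_mul_distrib, Finset.prod_range_reflect, Finset.prod_pow, sq]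
  have hconst : (2 : ℝ) ^ (2 * n) = ∏ _k ∈ Finset.range n, 2 ^ 2 := by
    rw [Finset.prod_const, Finset.card_range, pow_mul]
  rw [hshift, hreflect, hconst, ← Finset.prod_mul_distrib]
  refine (Finset.prod_congr rfl fun k hk => ?_).trans (prod_two_mul_sin_pi_div n)
  have hk' : k + 1 ≤ n := Finset.mem_range.mp hk
  have hcos : f (n - 1 - k) = cos ((k + 1 : ℕ) * π / (2 * (n + 1))) := by
    rw [hf, ← sin_pi_div_two_sub]
    dsimp only
    rw [show n - 1 - k + 1 = n - k by omega, Nat.cast_sub (by omega)]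
    congr 1
    push_cast
    field_simp
    ring
  rw [hcos, show ((k + 1 : ℕ) : ℝ) * π / (n + 1) = 2 * ((k + 1 : ℕ) * π / (2 * (n + 1))) by
    field_simp, sin_two_mul]
  ring
end

section
/- Let n be a positive integer and let C be the Cartan matrix of type A_n. Then the characteristic polynomial of C is p_n(x) = Σ_{j=0}^{n} (-1)^{n+j} · binomial(n+j+1, 2j+1) · x^j. -/
open Matrix Polynomial

/-- Expansion of the determinant of a symmetric tridiagonal Toeplitz matrix along its first row. -/
theorem det_tridiagonal_succ_succ {R : Type*} [CommRing R] (a b : R)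
    (M : (n : ℕ) → Matrix (Fin n) (Fin n) R)
    (hM : ∀ n i j, M n i j = if (i : ℕ) = (j : ℕ) then a
      else if (i : ℕ) + 1 = (j : ℕ) ∨ (j : ℕ) + 1 = (i : ℕ) then b else 0) (n : ℕ) :
    (M (n + 2)).det = a * (M (n + 1)).det - b ^ 2 * (M n).det := by
  have hfirst : (M (n + 2)).submatrix Fin.succ (Fin.succAbove 0) = M (n + 1) := by
    ext i j
    simp [hM]
  have hminor : ((M (n + 2)).submatrix Fin.succ (Fin.succAbove 1)).det = b * (M n).det := by
    have hsub : (((M (n + 2)).submatrix Fin.succ (Fin.succAbove 1)).submatrix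
        (Fin.succAbove 0) Fin.succ) = M n := by
      ext i j
      have hj : (Fin.succAbove (1 : Fin (n + 2)) j.succ : Fin (n + 2)) = j.succ.succ := by
        rw [← Fin.succ_zero_eq_one, Fin.succ_succAbove_succ]
        simp
      simp [hM, hj]
    rw [det_succ_column_zero, Fin.sum_univ_succ, hsub]
    simp [hM]
  rw [det_succ_row_zero, Fin.sum_univ_succ, Fin.sum_univ_succ, hfirst, Fin.succ_zero_eq_one,
    hminor]
  simp [hM]
  ring

theorem charpoly_cartanA_succ_succ (n : ℕ) :
    (cartanA (n + 2)).charpoly =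
      (X - C 2) * (cartanA (n + 1)).charpoly - (cartanA n).charpoly := by
  have h := det_tridiagonal_succ_succ (X - C 2 : ℤ[X]) 1 (fun n => (cartanA n).charmatrix)
    (fun n i j => by
      by_cases hij : i = j
      · simp [hij, cartanA]
      · have hne : (i : ℕ) ≠ j := fun h => hij (Fin.ext h)
        rw [charmatrix_apply_ne _ _ _ hij]
        simp only [cartanA, of_apply, hne, if_false]
        split_ifs <;> simp) n
  simpa [Matrix.charpoly] using h

theorem choose_add_four_two_mul_add_three (n j : ℕ) :
    (n + j + 4).choose (2 * j + 3) + (n + j + 2).choose (2 * j + 3) =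
      (n + j + 2).choose (2 * j + 1) + 2 * (n + j + 3).choose (2 * j + 3) := by
  have h₁ := Nat.choose_succ_succ (n + j + 3) (2 * j + 2)
  have h₂ := Nat.choose_succ_succ (n + j + 2) (2 * j + 2)
  have h₃ := Nat.choose_succ_succ (n + j + 2) (2 * j + 1)
  simp only [Nat.succ_eq_add_one, add_assoc, Nat.reduceAdd] at *
  omega

theorem coeff_charpoly_cartanA (n j : ℕ) :
    (cartanA n).charpoly.coeff j =
      (-1 : ℤ) ^ (n + j) * ((n + j + 1).choose (2 * j + 1) : ℤ) := by
  induction n using Nat.twoStepInduction generalizing j with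
  | zero =>
    rcases j with _ | j
    · simp [Matrix.charpoly]
    · rw [Nat.choose_eq_zero_of_lt (by omega)]
      simp [Matrix.charpoly, coeff_one]
  | one =>
    have h : (cartanA 1).charpoly = X - C 2 := by
      simp [Matrix.charpoly, cartanA]
    rw [h]
    rcases j with _ | _ | j
    · simp
    · simp [coeff_X, coeff_ofNat_succ]
    · rw [Nat.choose_eq_zero_of_lt (by omega)]
      simp [coeff_X]
  | more n ih₀ ih₁ =>
    rw [charpoly_cartanA_succ_succ, sub_mul, coeff_sub, coeff_sub, coeff_C_mul, ih₀, ih₁]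
    rcases j with _ | j
    · simp
      ring
    · rw [coeff_X_mul, ih₁]
      have h := choose_add_four_two_mul_add_three n j
      zify at h
      rw [show n + 2 + (j + 1) + 1 = n + j + 4 by ring, show n + 1 + j + 1 = n + j + 2 by ring,
        show n + 1 + (j + 1) + 1 = n + j + 3 by ring, show n + (j + 1) + 1 = n + j + 2 by ring,
        show 2 * (j + 1) + 1 = 2 * j + 3 by ring]
      linear_combination (-(-1 : ℤ) ^ (n + j + 1)) * h

theorem charpoly_cartanA_coeffs (n : ℕ) (hn : 0 < n) :
    (cartanA n).charpoly =
      ∑ j ∈ Finset.range (n + 1),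
        C ((-1 : ℤ) ^ (n + j) * ((n + j + 1).choose (2 * j + 1) : ℤ)) * X ^ j := by
  ext k
  simp only [finsetSum_coeff, coeff_C_mul_X_pow, coeff_charpoly_cartanA]
  rw [Finset.sum_ite_eq]
  split_ifs with hk
  · rfl
  · rw [Finset.mem_range] at hk
    rw [Nat.choose_eq_zero_of_lt (by omega)]
    simp
end

section
/- Let n ≥ 2 and let C be the Cartan matrix of type B_n (the n×n integer matrix with 2 on the main diagonal, -1 on the sub- and superdiagonal, except that the entry in row n-1, column n is -2). Then for every real number x, the characteristic polynomial of C evaluated at x equals 2·T_n(x/2 - 1), where T_n is the n-th Chebyshev polynomial of the first kind. -/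
open Matrix Polynomial

/-- The Cartan matrix of type `B n` (`n ≥ 2`): `2` on the diagonal, `-1` on the sub- and
superdiagonal, except that the entry in row `n-1`, column `n` (1-indexed) is `-2`. -/
def cartanB (n : ℕ) : Matrix (Fin n) (Fin n) ℤ :=
  Matrix.of fun i j =>
    if (i : ℕ) = (j : ℕ) then 2
    else if (i : ℕ) = n - 2 ∧ (j : ℕ) = n - 1 then -2
    else if (i : ℕ) + 1 = (j : ℕ) ∨ (j : ℕ) + 1 = (i : ℕ) then -1
    else 0

/-- Expansion of the determinant of a matrix whose first row and first column vanish beyond their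
first two entries. -/
theorem det_eq_of_first_row_col_tridiagonal {R : Type*} [CommRing R] {n : ℕ}
    (A : Matrix (Fin (n + 2)) (Fin (n + 2)) R)
    (hrow : ∀ j : Fin n, A 0 j.succ.succ = 0) (hcol : ∀ i : Fin n, A i.succ.succ 0 = 0) :
    A.det = A 0 0 * (A.submatrix Fin.succ Fin.succ).det -
      A 0 1 * A 1 0 *
        (A.submatrix (fun i : Fin n => i.succ.succ) (fun j : Fin n => j.succ.succ)).det := by
  have hminor : (A.submatrix Fin.succ (Fin.succAbove 1)).det =
      A 1 0 * (A.submatrix (fun i : Fin n => i.succ.succ) (fun j : Fin n => j.succ.succ)).det := by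
    rw [det_succ_column_zero, Fin.sum_univ_succ]
    simp [hcol, submatrix_submatrix, Function.comp_def, Fin.one_succAbove_succ]
  rw [det_succ_row_zero, Fin.sum_univ_succ, Fin.sum_univ_succ]
  simp [hrow, hminor]
  ring

theorem scalar_sub_cartanB_submatrix_succ (m : ℕ) (x : ℝ) :
    (scalar (Fin (m + 3)) x - (cartanB (m + 3)).map (Int.cast : ℤ → ℝ)).submatrix
        Fin.succ Fin.succ =
      scalar (Fin (m + 2)) x - (cartanB (m + 2)).map (Int.cast : ℤ → ℝ) := by
  ext i j
  simp [cartanB, diagonal_apply]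

theorem scalar_sub_cartanB_submatrix_succ_succ (m : ℕ) (x : ℝ) :
    (scalar (Fin (m + 3)) x - (cartanB (m + 3)).map (Int.cast : ℤ → ℝ)).submatrix
        (fun i : Fin (m + 1) => i.succ.succ) (fun j : Fin (m + 1) => j.succ.succ) =
      scalar (Fin (m + 1)) x - (cartanB (m + 1)).map (Int.cast : ℤ → ℝ) := by
  ext i j
  simp [cartanB, diagonal_apply]
  grind

theorem charpoly_cartanB_eval_add_three (m : ℕ) (x : ℝ) :
    ((cartanB (m + 3)).map (Int.cast : ℤ → ℝ)).charpoly.eval x =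
      (x - 2) * ((cartanB (m + 2)).map (Int.cast : ℤ → ℝ)).charpoly.eval x -
        ((cartanB (m + 1)).map (Int.cast : ℤ → ℝ)).charpoly.eval x := by
  simp only [eval_charpoly]
  rw [det_eq_of_first_row_col_tridiagonal, scalar_sub_cartanB_submatrix_succ,
    scalar_sub_cartanB_submatrix_succ_succ]
  · simp [cartanB]
  · intro j
    simp [cartanB, diagonal_apply_ne, (Fin.succ_ne_zero _).symm]
  · intro i
    simp [cartanB, diagonal_apply_ne]

theorem charpoly_cartanB_eval_add_one (m : ℕ) (x : ℝ) :
    ((cartanB (m + 1)).map (Int.cast : ℤ → ℝ)).charpoly.eval x =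
      2 * (Polynomial.Chebyshev.T ℝ ((m + 1 : ℕ) : ℤ)).eval (x / 2 - 1) := by
  induction m using Nat.twoStepInduction with
  | zero =>
    simp [eval_charpoly, cartanB]
    ring
  | one =>
    simp [eval_charpoly, cartanB, det_fin_two, Polynomial.Chebyshev.T_two]
    ring
  | more m ih₁ ih₂ =>
    rw [charpoly_cartanB_eval_add_three, ih₁, ih₂]
    have hT := congrArg (eval (x / 2 - 1)) (Polynomial.Chebyshev.T_add_two ℝ ((m + 1 : ℕ) : ℤ))
    simp only [eval_sub, eval_mul, eval_ofNat, eval_X] at hT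
    push_cast at hT ⊢
    rw [show (m : ℤ) + 2 + 1 = m + 1 + 2 by ring, hT]
    ring

theorem charpoly_cartanB_eq_chebyshevT (n : ℕ) (hn : 2 ≤ n) (x : ℝ) :
    (((cartanB n).map (Int.cast : ℤ → ℝ)).charpoly).eval x =
      2 * (Polynomial.Chebyshev.T ℝ (n : ℤ)).eval (x / 2 - 1) := by
  obtain ⟨m, rfl⟩ := Nat.exists_eq_add_of_le' (one_le_two.trans hn)
  exact charpoly_cartanB_eval_add_one m x
end

section
/- For every positive integer n, 2^{2n} · ∏_{j=1}^{n} sin²((2j-1)π/(4n)) = 2 (the B_n sine formula). -/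
open Real

open Polynomial in
theorem two_pow_mul_prod_one_sub_cos (n : ℕ) :
    2 ^ (n - 1) * ∏ k ∈ Finset.range n, (1 - cos ((2 * k + 1) * π / (2 * n))) = 1 := by
  have hroots : (Chebyshev.T ℝ n).roots =
      (Finset.range n).val.map fun k : ℕ ↦ cos ((2 * k + 1) * π / (2 * n)) := by
    rw [Chebyshev.roots_T_real, Finset.image_val]
    exact (Chebyshev.roots_T_real_nodup n).dedup
  have hcard : (Chebyshev.T ℝ n).roots.card = (Chebyshev.T ℝ n).natDegree := by
    simp [hroots]
  have h := congrArg (eval 1) (C_leadingCoeff_mul_prod_multiset_X_sub_C hcard)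
  simpa [hroots, eval_multiset_prod, Multiset.map_map, Finset.prod] using h

theorem sine_formula_Bn (n : ℕ) (hn : 0 < n) :
    2 ^ (2 * n) * ∏ j ∈ Finset.Icc 1 n,
      Real.sin ((2 * j - 1) * Real.pi / (4 * n)) ^ 2 = 2 := by
  have hprod : ∏ k ∈ Finset.range n, (1 - cos ((2 * k + 1) * π / (2 * n))) =
      2 ^ n * ∏ j ∈ Finset.Icc 1 n, sin ((2 * j - 1) * π / (4 * n)) ^ 2 := by
    rw [← Finset.Ico_add_one_right_eq_Icc, Finset.prod_Ico_eq_prod_range, add_tsub_cancel_right,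
      Finset.pow_eq_prod_const, ← Finset.prod_mul_distrib]
    refine Finset.prod_congr rfl fun k _ ↦ ?_
    rw [sin_sq_eq_half_sub]
    push_cast
    ring_nf
  have h := two_pow_mul_prod_one_sub_cos n
  obtain ⟨m, rfl⟩ := Nat.exists_eq_add_of_lt hn
  rw [hprod] at h
  simp only [zero_add, add_tsub_cancel_right] at h ⊢
  linear_combination 2 * h
end

section
/- Let n ≥ 2 and let C be the Cartan matrix of type B_n. Then the characteristic polynomial of C is p_n(x) = Σ_{j=0}^{n} (-1)^{n+j} · (2n · (n+j-1)!) / ((n-j)! · (2j)!) · x^j. -/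
open Matrix Polynomial

/-- Expansion of the determinant of a matrix whose first row and first column vanish beyond their
first two entries. -/
theorem det_succ_succ_of_first_row_col {R : Type*} [CommRing R] {n : ℕ}
    (A : Matrix (Fin (n + 2)) (Fin (n + 2)) R)
    (hrow : ∀ j : Fin n, A 0 j.succ.succ = 0) (hcol : ∀ i : Fin n, A i.succ.succ 0 = 0) :
    A.det = A 0 0 * (A.submatrix Fin.succ Fin.succ).det -
      A 0 1 * A 1 0 *
        (A.submatrix (Fin.succ ∘ Fin.succ) (Fin.succ ∘ Fin.succ)).det := by
  have hminor : (A.submatrix Fin.succ (Fin.succAbove 1)).det =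
      A 1 0 * (A.submatrix (Fin.succ ∘ Fin.succ) (Fin.succ ∘ Fin.succ)).det := by
    have hskip : Fin.succAbove (1 : Fin (n + 2)) ∘ Fin.succ = Fin.succ ∘ Fin.succ := by
      funext j
      simp only [Function.comp_apply]
      rw [← Fin.succ_zero_eq_one, Fin.succ_succAbove_succ, Fin.succAbove_zero]
    rw [det_succ_column_zero, Fin.sum_univ_succ]
    simp [hskip, hcol]
  rw [det_succ_row_zero, Fin.sum_univ_succ, Fin.sum_univ_succ]
  simp only [Fin.succ_zero_eq_one, hminor]
  simp [hrow]
  ring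

theorem cartanB_succ_submatrix (n : ℕ) :
    (cartanB (n + 2)).submatrix Fin.succ Fin.succ = cartanB (n + 1) := by
  ext i j
  have hi := i.isLt
  have hj := j.isLt
  simp only [cartanB, submatrix_apply, of_apply, Fin.val_succ]
  split_ifs <;> first | rfl | omega

theorem charmatrix_submatrix_of_injective {R m n : Type*} [CommRing R] [DecidableEq m]
    [DecidableEq n] [Fintype m] [Fintype n] (A : Matrix n n R) {f : m → n}
    (hf : Function.Injective f) :
    A.charmatrix.submatrix f f = (A.submatrix f f).charmatrix := by
  ext1 i j
  simp [charmatrix_apply, diagonal_apply, hf.eq_iff]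

theorem charpoly_cartanB_add_two (n : ℕ) (hn : 1 ≤ n) :
    (cartanB (n + 2)).charpoly =
      (X - 2) * (cartanB (n + 1)).charpoly - (cartanB n).charpoly := by
  obtain ⟨n, rfl⟩ := Nat.exists_eq_add_of_le' hn
  have h00 : cartanB (n + 1 + 2) 0 0 = 2 := by simp [cartanB]
  have h01 : cartanB (n + 1 + 2) 0 1 = -1 := by simp [cartanB]
  have h10 : cartanB (n + 1 + 2) 1 0 = -1 := by simp [cartanB]
  have hsub : (cartanB (n + 1 + 2)).submatrix (Fin.succ ∘ Fin.succ) (Fin.succ ∘ Fin.succ) =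
      cartanB (n + 1) := by
    rw [← cartanB_succ_submatrix n, ← cartanB_succ_submatrix (n + 1), submatrix_submatrix]
  rw [charpoly, det_succ_succ_of_first_row_col,
    charmatrix_submatrix_of_injective _ (Fin.succ_injective _),
    charmatrix_submatrix_of_injective _
      ((Fin.succ_injective _).comp (Fin.succ_injective _)), hsub, cartanB_succ_submatrix]
  · rw [charmatrix_apply_eq, charmatrix_apply_ne _ _ _ (by simp),
      charmatrix_apply_ne _ _ _ (by simp), h00, h01, h10]
    simp [charpoly]
  · intro j
    rw [charmatrix_apply_ne _ _ _ (Fin.succ_ne_zero _).symm]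
    simp [cartanB]
  · intro i
    rw [charmatrix_apply_ne _ _ _ (Fin.succ_ne_zero _)]
    simp [cartanB]

/-- The coefficient of `x ^ j` in the characteristic polynomial of the Cartan matrix of
type `B n`, for `j ≤ n`. -/
def cartanBCoeff (n j : ℕ) : ℚ :=
  (-1 : ℚ) ^ (n + j) * (2 * n * (Nat.factorial (n + j - 1) : ℚ)) /
    ((Nat.factorial (n - j) : ℚ) * (Nat.factorial (2 * j) : ℚ))

theorem cartanBCoeff_zero (n : ℕ) (hn : 1 ≤ n) : cartanBCoeff n 0 = 2 * (-1) ^ n := by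
  obtain ⟨n, rfl⟩ := Nat.exists_eq_add_of_le' hn
  have := Nat.factorial_ne_zero n
  simp only [cartanBCoeff, Nat.add_zero, Nat.add_sub_cancel, Nat.sub_zero, Nat.mul_zero,
    Nat.factorial_zero, Nat.factorial_succ]
  push_cast
  field_simp

theorem cartanBCoeff_self (n : ℕ) (hn : 1 ≤ n) : cartanBCoeff n n = 1 := by
  obtain ⟨n, rfl⟩ := Nat.exists_eq_add_of_le' hn
  have := Nat.factorial_ne_zero (2 * n + 1)
  have h1 : n + 1 + (n + 1) - 1 = 2 * n + 1 := by omega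
  have h2 : 2 * (n + 1) = 2 * n + 1 + 1 := by ring
  rw [cartanBCoeff, h1, h2, Nat.factorial_succ (2 * n + 1), Even.neg_one_pow ⟨n + 1, rfl⟩]
  simp only [Nat.sub_self, Nat.factorial_zero]
  push_cast
  field_simp
  ring

theorem cartanBCoeff_succ_self (n : ℕ) : cartanBCoeff (n + 1) n = -(2 * (n + 1)) := by
  have := Nat.factorial_ne_zero (2 * n)
  have h1 : n + 1 + n - 1 = 2 * n := by omega
  have h2 : n + 1 - n = 1 := by omega
  have h3 : n + 1 + n = 2 * n + 1 := by ring
  rw [cartanBCoeff, h1, h2, h3, Odd.neg_one_pow ⟨n, rfl⟩]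
  simp only [Nat.factorial_one]
  push_cast
  field_simp

theorem cartanBCoeff_add_two_succ (n k : ℕ) (hk : k + 1 ≤ n) :
    cartanBCoeff (n + 2) (k + 1) =
      cartanBCoeff (n + 1) k - 2 * cartanBCoeff (n + 1) (k + 1) - cartanBCoeff n (k + 1) := by
  obtain ⟨m, rfl⟩ := Nat.exists_eq_add_of_le' hk
  have hm := Nat.factorial_ne_zero m
  have hk := Nat.factorial_ne_zero (2 * k)
  have e1 : m + (k + 1) + 2 + (k + 1) - 1 = m + 2 * k + 1 + 1 + 1 := by omega
  have e2 : m + (k + 1) + 1 + k - 1 = m + 2 * k + 1 := by omega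
  have e3 : m + (k + 1) + 1 + (k + 1) - 1 = m + 2 * k + 1 + 1 := by omega
  have e4 : m + (k + 1) + (k + 1) - 1 = m + 2 * k + 1 := by omega
  have f1 : m + (k + 1) + 2 - (k + 1) = m + 1 + 1 := by omega
  have f2 : m + (k + 1) + 1 - k = m + 1 + 1 := by omega
  have f3 : m + (k + 1) + 1 - (k + 1) = m + 1 := by omega
  have f4 : m + (k + 1) - (k + 1) = m := by omega
  have g : 2 * (k + 1) = 2 * k + 1 + 1 := by ring
  simp only [cartanBCoeff, e1, e2, e3, e4, f1, f2, f3, f4, g,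
    Nat.factorial_succ (m + 2 * k + 1 + 1), Nat.factorial_succ (m + 2 * k + 1),
    Nat.factorial_succ (m + 1), Nat.factorial_succ m, Nat.factorial_succ (2 * k + 1),
    Nat.factorial_succ (2 * k)]
  generalize Nat.factorial (m + 2 * k + 1) = F
  push_cast
  field_simp
  ring

/-- The explicit form of the characteristic polynomial of the Cartan matrix of type `B n`. -/
noncomputable def cartanBPoly (n : ℕ) : ℚ[X] :=
  ∑ j ∈ Finset.range (n + 1), C (cartanBCoeff n j) * X ^ j

theorem coeff_cartanBPoly (n k : ℕ) :
    (cartanBPoly n).coeff k = if k ≤ n then cartanBCoeff n k else 0 := by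
  simp [cartanBPoly, finsetSum_coeff]

theorem cartanBPoly_add_two (n : ℕ) (hn : 1 ≤ n) :
    cartanBPoly (n + 2) = (X - 2) * cartanBPoly (n + 1) - cartanBPoly n := by
  have h2 : (2 : ℚ[X]) = C 2 := rfl
  ext k
  cases k with
  | zero =>
    simp only [h2, sub_mul, coeff_sub, coeff_X_mul_zero, coeff_C_mul, coeff_cartanBPoly,
      Nat.zero_le, if_true]
    rw [cartanBCoeff_zero _ (by omega), cartanBCoeff_zero _ (by omega), cartanBCoeff_zero _ hn]
    ring
  | succ k =>
    simp only [h2, sub_mul, coeff_sub, coeff_X_mul, coeff_C_mul, coeff_cartanBPoly]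
    rcases Nat.lt_or_ge k n with hk | hk
    · rw [if_pos (by omega), if_pos (by omega), if_pos (by omega), if_pos (by omega),
        cartanBCoeff_add_two_succ n k hk]
    · rcases hk.eq_or_lt with rfl | hk
      · rw [if_pos (by omega), if_pos (by omega), if_pos (by omega), if_neg (by omega),
          cartanBCoeff_succ_self, cartanBCoeff_succ_self, cartanBCoeff_self _ (by omega)]
        push_cast
        ring
      · obtain rfl | hk := (Nat.succ_le_of_lt hk).eq_or_lt
        · rw [if_pos (by omega), if_pos (by omega), if_neg (by omega), if_neg (by omega),
            cartanBCoeff_self _ (by omega), cartanBCoeff_self _ (by omega)]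
          ring
        · rw [if_neg (by omega), if_neg (by omega), if_neg (by omega), if_neg (by omega)]
          ring

theorem map_charpoly_cartanB_add_one (n : ℕ) :
    (cartanB (n + 1)).charpoly.map (Int.castRingHom ℚ) = cartanBPoly (n + 1) := by
  have h2 : (C 2 : ℚ[X]) = 2 := rfl
  have h4 : (C 4 : ℚ[X]) = 4 := rfl
  induction n using Nat.twoStepInduction with
  | zero =>
    simp [charpoly, h2, cartanB, cartanBPoly, cartanBCoeff, Finset.sum_range_succ]
    ring
  | one =>
    simp [charpoly, det_fin_two, h2, cartanB, cartanBPoly, cartanBCoeff,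
      Finset.sum_range_succ, Nat.factorial]
    norm_num [h4]
    ring
  | more n ih₁ ih₂ =>
    rw [charpoly_cartanB_add_two (n + 1) (by omega), cartanBPoly_add_two (n + 1) (by omega),
      ← ih₁, ← ih₂]
    simp

theorem charpoly_cartanB_coeffs (n : ℕ) (hn : 2 ≤ n) :
    ((cartanB n).charpoly).map (Int.castRingHom ℚ) =
      ∑ j ∈ Finset.range (n + 1),
        C ((-1 : ℚ) ^ (n + j) *
          (2 * n * (Nat.factorial (n + j - 1) : ℚ)) /
            ((Nat.factorial (n - j) : ℚ) * (Nat.factorial (2 * j) : ℚ))) * X ^ j := by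
  obtain ⟨n, rfl⟩ := Nat.exists_eq_add_of_le' (one_le_two.trans hn)
  exact map_charpoly_cartanB_add_one n
end

section
/- Let n ≥ 3 and let C be the Cartan matrix of type D_n (the n×n integer matrix with 2 on the main diagonal, -1 in positions (i, i+1) and (i+1, i) for 1 ≤ i ≤ n-2, -1 in positions (n-2, n) and (n, n-2), and 0 elsewhere). Then for every real number x, the characteristic polynomial of C evaluated at x equals (2x - 4)·T_{n-1}(x/2 - 1), where T_{n-1} is the (n-1)-st Chebyshev polynomial of the first kind. -/
open Matrix Polynomial

/-- The Cartan matrix of type `D n` (`n ≥ 3`): `2` on the diagonal, `-1` in positions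
`(i, i+1)` and `(i+1, i)` for `1 ≤ i ≤ n-2` (1-indexed), `-1` in positions `(n-2, n)` and
`(n, n-2)`, and `0` elsewhere. -/
def cartanD (n : ℕ) : Matrix (Fin n) (Fin n) ℤ :=
  Matrix.of fun i j =>
    if (i : ℕ) = (j : ℕ) then 2
    else if ((i : ℕ) + 1 = (j : ℕ) ∧ (j : ℕ) ≤ n - 2) ∨
            ((j : ℕ) + 1 = (i : ℕ) ∧ (i : ℕ) ≤ n - 2) ∨
            ((i : ℕ) = n - 3 ∧ (j : ℕ) = n - 1) ∨
            ((j : ℕ) = n - 3 ∧ (i : ℕ) = n - 1) then -1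
    else 0

/-- Expansion of a determinant whose first row and first column vanish beyond their second
entry. -/
theorem Matrix.det_eq_of_tridiagonal_head {R : Type*} [CommRing R] {n : ℕ}
    (M : Matrix (Fin (n + 2)) (Fin (n + 2)) R)
    (hrow : ∀ j : Fin n, M 0 j.succ.succ = 0) (hcol : ∀ i : Fin n, M i.succ.succ 0 = 0) :
    M.det = M 0 0 * (M.submatrix Fin.succ Fin.succ).det -
      M 0 1 * M 1 0 *
        (M.submatrix (fun i : Fin n => i.succ.succ) (fun j : Fin n => j.succ.succ)).det := by
  have hminor : (M.submatrix Fin.succ (Fin.succAbove 1)).det = M 1 0 *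
      (M.submatrix (fun i : Fin n => i.succ.succ) (fun j : Fin n => j.succ.succ)).det := by
    rw [det_succ_column_zero, Fin.sum_univ_succ, Finset.sum_eq_zero]
    · have hsub : ∀ j : Fin n, Fin.succAbove (1 : Fin (n + 2)) j.succ = j.succ.succ := fun j => by
        rw [← Fin.succ_zero_eq_one, Fin.succ_succAbove_succ, Fin.succAbove_zero]
      simp [submatrix_submatrix, Function.comp_def, hsub]
    · intro i _
      simp [hcol]
  rw [det_succ_row_zero, Fin.sum_univ_succ, Fin.sum_univ_succ, Finset.sum_eq_zero]
  · simp only [Fin.succ_zero_eq_one, hminor, Fin.succAbove_zero, Fin.val_zero, Fin.val_one]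
    ring
  · intro j _
    simp [hrow]

theorem scalar_sub_cartanD_apply (n : ℕ) (x : ℝ) (i j : Fin n) :
    (scalar (Fin n) x - (cartanD n).map (Int.cast : ℤ → ℝ)) i j =
      if (i : ℕ) = j then x - 2
      else if ((i : ℕ) + 1 = (j : ℕ) ∧ (j : ℕ) ≤ n - 2) ∨
            ((j : ℕ) + 1 = (i : ℕ) ∧ (i : ℕ) ≤ n - 2) ∨
            ((i : ℕ) = n - 3 ∧ (j : ℕ) = n - 1) ∨
            ((j : ℕ) = n - 3 ∧ (i : ℕ) = n - 1) then 1
      else 0 := by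
  simp only [cartanD, Matrix.sub_apply, scalar_apply, diagonal_apply, map_apply, of_apply, Fin.ext_iff]
  split_ifs <;> simp

theorem scalar_sub_cartanD_submatrix_succ (n : ℕ) (hn : 3 ≤ n) (x : ℝ) :
    (scalar (Fin (n + 1)) x - (cartanD (n + 1)).map (Int.cast : ℤ → ℝ)).submatrix
        Fin.succ Fin.succ =
      scalar (Fin n) x - (cartanD n).map (Int.cast : ℤ → ℝ) := by
  ext i j
  rw [submatrix_apply, scalar_sub_cartanD_apply, scalar_sub_cartanD_apply]
  simp only [Fin.val_succ]
  congr 1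
  · simp
  · congr 1
    apply propext
    omega

theorem det_scalar_sub_cartanD_three (x : ℝ) :
    (scalar (Fin 3) x - (cartanD 3).map (Int.cast : ℤ → ℝ)).det =
      (x - 2) ^ 3 - 2 * (x - 2) := by
  rw [det_fin_three]
  simp only [scalar_sub_cartanD_apply]
  norm_num
  ring

theorem det_scalar_sub_cartanD_add_two (n : ℕ) (hn : 2 ≤ n) (x : ℝ) :
    (scalar (Fin (n + 2)) x - (cartanD (n + 2)).map (Int.cast : ℤ → ℝ)).det =
      (x - 2) * (scalar (Fin (n + 1)) x - (cartanD (n + 1)).map (Int.cast : ℤ → ℝ)).det -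
        ((scalar (Fin (n + 2)) x - (cartanD (n + 2)).map (Int.cast : ℤ → ℝ)).submatrix
          (fun i : Fin n => i.succ.succ) (fun j : Fin n => j.succ.succ)).det := by
  rw [det_eq_of_tridiagonal_head, scalar_sub_cartanD_submatrix_succ (n + 1) (by omega)]
  · have h00 := scalar_sub_cartanD_apply (n + 2) x 0 0
    have h01 := scalar_sub_cartanD_apply (n + 2) x 0 1
    have h10 := scalar_sub_cartanD_apply (n + 2) x 1 0
    rw [if_pos rfl] at h00
    rw [if_neg (by simp), if_pos (by simp; omega)] at h01 h10
    rw [h00, h01, h10]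
    ring
  all_goals
    intro k
    rw [scalar_sub_cartanD_apply, if_neg (by simp), if_neg]
    simp only [Fin.val_succ, Fin.val_zero]
    omega

theorem det_scalar_sub_cartanD_four (x : ℝ) :
    (scalar (Fin 4) x - (cartanD 4).map (Int.cast : ℤ → ℝ)).det =
      (x - 2) ^ 4 - 3 * (x - 2) ^ 2 := by
  rw [det_scalar_sub_cartanD_add_two 2 le_rfl, det_scalar_sub_cartanD_three, det_fin_two]
  simp only [submatrix_apply, scalar_sub_cartanD_apply]
  norm_num
  ring

theorem det_scalar_sub_cartanD_recurrence (n : ℕ) (hn : 3 ≤ n) (x : ℝ) :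
    (scalar (Fin (n + 2)) x - (cartanD (n + 2)).map (Int.cast : ℤ → ℝ)).det =
      (x - 2) * (scalar (Fin (n + 1)) x - (cartanD (n + 1)).map (Int.cast : ℤ → ℝ)).det -
        (scalar (Fin n) x - (cartanD n).map (Int.cast : ℤ → ℝ)).det := by
  rw [det_scalar_sub_cartanD_add_two n (by omega), ← scalar_sub_cartanD_submatrix_succ n hn,
    ← scalar_sub_cartanD_submatrix_succ (n + 1) (by omega), submatrix_submatrix]
  rfl

theorem det_scalar_sub_cartanD (n : ℕ) (x : ℝ) :
    (scalar (Fin (n + 3)) x - (cartanD (n + 3)).map (Int.cast : ℤ → ℝ)).det =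
      (2 * x - 4) * (Polynomial.Chebyshev.T ℝ ((n : ℤ) + 2)).eval (x / 2 - 1) := by
  induction n using Nat.twoStepInduction with
  | zero =>
    rw [det_scalar_sub_cartanD_three]
    simp [Chebyshev.T_two]
    ring
  | one =>
    rw [det_scalar_sub_cartanD_four, Nat.cast_one, Chebyshev.T_add_two]
    simp [Chebyshev.T_two]
    ring
  | more n ih₀ ih₁ =>
    rw [det_scalar_sub_cartanD_recurrence (n + 3) (by omega), ih₀,
      show n + 3 + 1 = n + 1 + 3 by ring, ih₁]
    push_cast
    rw [Chebyshev.T_add_two ℝ ((n : ℤ) + 2), show (n : ℤ) + 2 + 1 = n + 1 + 2 by ring]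
    simp only [eval_sub, eval_mul, eval_ofNat, eval_X]
    ring

theorem charpoly_cartanD_eq_chebyshevT (n : ℕ) (hn : 3 ≤ n) (x : ℝ) :
    (((cartanD n).map (Int.cast : ℤ → ℝ)).charpoly).eval x =
      (2 * x - 4) * (Polynomial.Chebyshev.T ℝ ((n : ℤ) - 1)).eval (x / 2 - 1) := by
  obtain ⟨m, rfl⟩ := Nat.exists_eq_add_of_le' hn
  rw [eval_charpoly, det_scalar_sub_cartanD]
  congr 3
  push_cast
  ring
end

section
/- Let n ≥ 3 and let C be the Cartan matrix of type D_n. Then the characteristic polynomial of C is p_n(x) = (x - 2) · Σ_{j=0}^{n-1} (-1)^{n+j+1} · ((2n-2) · (n+j-2)!) / ((n-j-1)! · (2j)!) · x^j. -/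
open Matrix Polynomial

/-- Continuant expansion of a determinant whose first row and first column vanish beyond their
first two entries. -/
theorem Matrix.det_eq_of_first_row_col {R : Type*} [CommRing R] {n : ℕ}
    (M : Matrix (Fin (n + 2)) (Fin (n + 2)) R)
    (hrow : ∀ j : Fin n, M 0 j.succ.succ = 0) (hcol : ∀ i : Fin n, M i.succ.succ 0 = 0) :
    M.det = M 0 0 * (M.submatrix Fin.succ Fin.succ).det -
      M 0 1 * M 1 0 *
        (M.submatrix (fun i : Fin n => i.succ.succ) (fun i : Fin n => i.succ.succ)).det := by
  have hminor : (M.submatrix Fin.succ (Fin.succAbove 1)).det = M 1 0 *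
      (M.submatrix (fun i : Fin n => i.succ.succ) (fun i : Fin n => i.succ.succ)).det := by
    rw [det_succ_column_zero, Fin.sum_univ_succ]
    have hsub : (M.submatrix Fin.succ (Fin.succAbove 1)).submatrix (Fin.succAbove 0) Fin.succ =
        M.submatrix (fun i : Fin n => i.succ.succ) (fun i : Fin n => i.succ.succ) := by
      ext i j
      have h : (Fin.succAbove 1 j.succ : Fin (n + 2)) = j.succ.succ := by
        rw [← Fin.succ_zero_eq_one, Fin.succ_succAbove_succ, Fin.zero_succAbove]
      simp [h]
    rw [hsub]
    simp [hcol]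
  rw [det_succ_row_zero, Fin.sum_univ_succ, Fin.sum_univ_succ]
  simp only [hrow, Fin.succ_zero_eq_one, hminor]
  simp
  ring

theorem cartanD_succ_succ (n : ℕ) (hn : 3 ≤ n) (i j : Fin n) :
    cartanD (n + 1) i.succ j.succ = cartanD n i j := by
  simp only [cartanD, of_apply, Fin.val_succ]
  congr 1
  · simp
  · congr 1
    apply propext
    omega

theorem charpoly_cartanD_add_two (n : ℕ) (hn : 2 ≤ n) :
    (cartanD (n + 2)).charpoly = (X - C 2) * (cartanD (n + 1)).charpoly -
      ((cartanD (n + 2)).submatrix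
        (fun i : Fin n => i.succ.succ) (fun i : Fin n => i.succ.succ)).charpoly := by
  have h01 : cartanD (n + 2) 0 1 = -1 := by simp [cartanD]; omega
  have h10 : cartanD (n + 2) 1 0 = -1 := by simp [cartanD]; omega
  rw [charpoly, det_eq_of_first_row_col]
  · have h1 : (charmatrix (cartanD (n + 2))).submatrix Fin.succ Fin.succ =
        charmatrix (cartanD (n + 1)) := by
      ext1 i j
      simp [charmatrix_apply, diagonal_apply, cartanD_succ_succ (n + 1) (by omega)]
    have h2 : (charmatrix (cartanD (n + 2))).submatrix
          (fun i : Fin n => i.succ.succ) (fun i : Fin n => i.succ.succ) =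
        charmatrix ((cartanD (n + 2)).submatrix
          (fun i : Fin n => i.succ.succ) (fun i : Fin n => i.succ.succ)) := by
      ext1 i j
      simp [charmatrix_apply, diagonal_apply]
    rw [h1, h2, charmatrix_apply_ne _ 0 1 (by simp), charmatrix_apply_ne _ 1 0 (by simp), h01, h10,
      charmatrix_apply_eq]
    simp [charpoly, cartanD]
  · intro j
    rw [charmatrix_apply_ne _ _ _ (Fin.succ_ne_zero _).symm]
    simp [cartanD]
    omega
  · intro j
    rw [charmatrix_apply_ne _ _ _ (Fin.succ_ne_zero _)]
    simp [cartanD]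
    omega

theorem charpoly_cartanD_recurrence (n : ℕ) (hn : 3 ≤ n) :
    (cartanD (n + 2)).charpoly =
      (X - C 2) * (cartanD (n + 1)).charpoly - (cartanD n).charpoly := by
  rw [charpoly_cartanD_add_two n (by omega)]
  congr 2
  ext i j
  simp [cartanD_succ_succ (n + 1) (by omega), cartanD_succ_succ n hn]

theorem charpoly_cartanD_three :
    (cartanD 3).charpoly = (X - C 2) * (X ^ 2 - 4 * X + 2) := by
  simp [charpoly, det_fin_three, cartanD]
  ring

theorem charpoly_cartanD_four :
    (cartanD 4).charpoly = (X - C 2) * (X ^ 3 - 6 * X ^ 2 + 9 * X - 2) := by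
  rw [charpoly_cartanD_add_two 2 le_rfl, charpoly_cartanD_three]
  simp [charpoly, det_fin_two, cartanD]
  ring

/-- The coefficient of `X ^ j` in the cofactor of `X - 2` in the characteristic polynomial of
`cartanD n`, for `j < n`. -/
def cartanDCoeff (n j : ℕ) : ℚ :=
  (-1 : ℚ) ^ (n + j + 1) * ((2 * n - 2) * (Nat.factorial (n + j - 2) : ℚ)) /
    ((Nat.factorial (n - j - 1) : ℚ) * (Nat.factorial (2 * j) : ℚ))

theorem cartanDCoeff_zero (n : ℕ) (hn : 2 ≤ n) : cartanDCoeff n 0 = (-1) ^ (n + 1) * 2 := by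
  obtain ⟨m, rfl⟩ := Nat.exists_eq_add_of_le' hn
  have := Nat.factorial_ne_zero m
  simp only [cartanDCoeff, show m + 2 + 0 - 2 = m by omega, show m + 2 - 0 - 1 = m + 1 by omega,
    Nat.factorial_succ]
  push_cast
  field_simp
  simp
  ring

theorem cartanDCoeff_self_succ (m : ℕ) : cartanDCoeff (m + 2) (m + 1) = 1 := by
  have := Nat.factorial_ne_zero (2 * m + 1)
  simp only [cartanDCoeff, show m + 2 + (m + 1) - 2 = 2 * m + 1 by omega,
    show m + 2 - (m + 1) - 1 = 0 by omega, show 2 * (m + 1) = 2 * m + 1 + 1 by ring,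
    show m + 2 + (m + 1) + 1 = 2 * (m + 2) by ring, pow_mul]
  rw [Nat.factorial_succ (2 * m + 1)]
  push_cast
  field_simp
  simp
  ring

theorem cartanDCoeff_subleading (m : ℕ) : cartanDCoeff (m + 2) m = -(2 * m + 2) := by
  have := Nat.factorial_ne_zero (2 * m)
  simp only [cartanDCoeff, show m + 2 + m - 2 = 2 * m by omega,
    show m + 2 - m - 1 = 1 by omega,
    show m + 2 + m + 1 = 2 * (m + 1) + 1 by ring, pow_succ, pow_mul]
  push_cast
  field_simp
  simp
  ring

theorem cartanDCoeff_recurrence (j k : ℕ) :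
    cartanDCoeff (j + k + 4) (j + 1) = cartanDCoeff (j + k + 3) j -
      2 * cartanDCoeff (j + k + 3) (j + 1) - cartanDCoeff (j + k + 2) (j + 1) := by
  have := Nat.factorial_ne_zero (2 * j)
  have := Nat.factorial_ne_zero k
  simp only [cartanDCoeff, show j + k + 4 + (j + 1) - 2 = 2 * j + k + 1 + 1 + 1 by omega,
    show j + k + 3 + j - 2 = 2 * j + k + 1 by omega,
    show j + k + 3 + (j + 1) - 2 = 2 * j + k + 1 + 1 by omega,
    show j + k + 2 + (j + 1) - 2 = 2 * j + k + 1 by omega,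
    show j + k + 4 - (j + 1) - 1 = k + 1 + 1 by omega,
    show j + k + 3 - j - 1 = k + 1 + 1 by omega,
    show j + k + 3 - (j + 1) - 1 = k + 1 by omega,
    show j + k + 2 - (j + 1) - 1 = k by omega,
    show 2 * (j + 1) = 2 * j + 1 + 1 by ring,
    show j + k + 4 + (j + 1) + 1 = 2 * j + k + 4 + 2 by ring,
    show j + k + 3 + j + 1 = 2 * j + k + 4 by ring,
    show j + k + 3 + (j + 1) + 1 = 2 * j + k + 4 + 1 by ring,
    show j + k + 2 + (j + 1) + 1 = 2 * j + k + 4 by ring]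
  rw [Nat.factorial_succ (2 * j + k + 1 + 1), Nat.factorial_succ (2 * j + k + 1),
    Nat.factorial_succ (k + 1), Nat.factorial_succ k, Nat.factorial_succ (2 * j + 1),
    Nat.factorial_succ (2 * j), pow_add _ _ 2, pow_add _ _ 1]
  generalize (-1 : ℚ) ^ (2 * j + k + 4) = s
  generalize Nat.factorial (2 * j + k + 1) = a
  push_cast
  field_simp
  ring

/-- The cofactor of `X - 2` in the characteristic polynomial of `cartanD n`. -/
noncomputable def cartanDCofactor (n : ℕ) : ℚ[X] :=
  ∑ j ∈ Finset.range n, C (cartanDCoeff n j) * X ^ j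

theorem coeff_cartanDCofactor (n j : ℕ) :
    (cartanDCofactor n).coeff j = if j < n then cartanDCoeff n j else 0 := by
  simp [cartanDCofactor, finsetSum_coeff, coeff_X_pow]

theorem cartanDCofactor_add_two (n : ℕ) (hn : 2 ≤ n) :
    cartanDCofactor (n + 2) = (X - C 2) * cartanDCofactor (n + 1) - cartanDCofactor n := by
  ext j
  rcases j with _ | j
  · simp only [sub_mul, coeff_sub, coeff_C_mul, coeff_X_mul_zero, coeff_cartanDCofactor]
    rw [if_pos (by omega), if_pos (by omega), if_pos (by omega), cartanDCoeff_zero _ (by omega),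
      cartanDCoeff_zero _ (by omega), cartanDCoeff_zero _ (by omega)]
    ring
  · simp only [sub_mul, coeff_sub, coeff_C_mul, coeff_X_mul, coeff_cartanDCofactor]
    rcases lt_trichotomy (j + 1) n with h | h | h
    · obtain ⟨k, rfl⟩ := Nat.exists_eq_add_of_le (show j + 2 ≤ n by omega)
      simp only [show j + 2 + k = j + k + 2 by ring]
      rw [if_pos (by omega), if_pos (by omega), if_pos (by omega), if_pos (by omega),
        cartanDCoeff_recurrence]
    · subst h
      obtain ⟨m, rfl⟩ := Nat.exists_eq_add_of_le' (show 1 ≤ j by omega)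
      rw [if_pos (by omega), if_pos (by omega), if_pos (by omega), if_neg (by omega),
        cartanDCoeff_self_succ, cartanDCoeff_subleading, cartanDCoeff_subleading]
      push_cast
      ring
    · rcases Nat.eq_or_lt_of_le (show n ≤ j by omega) with rfl | h'
      · obtain ⟨m, rfl⟩ := Nat.exists_eq_add_of_le' (show 1 ≤ n by omega)
        rw [if_pos (by omega), if_pos (by omega), if_neg (by omega), if_neg (by omega),
          cartanDCoeff_self_succ, cartanDCoeff_self_succ]
        ring
      · rw [if_neg (by omega), if_neg (by omega), if_neg (by omega), if_neg (by omega)]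
        ring

theorem cartanDCofactor_two : cartanDCofactor 2 = X - C 2 := by
  have h0 : cartanDCoeff 2 0 = -2 := by norm_num [cartanDCoeff_zero]
  have h1 : cartanDCoeff 2 1 = 1 := cartanDCoeff_self_succ 0
  simp [cartanDCofactor, Finset.sum_range_succ, h0, h1]
  ring

theorem cartanDCofactor_three : cartanDCofactor 3 = X ^ 2 - 4 * X + 2 := by
  have h0 : cartanDCoeff 3 0 = 2 := by norm_num [cartanDCoeff_zero]
  have h1 : cartanDCoeff 3 1 = -4 := by rw [cartanDCoeff_subleading 1]; norm_num
  have h2 : cartanDCoeff 3 2 = 1 := cartanDCoeff_self_succ 1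
  simp [cartanDCofactor, Finset.sum_range_succ, h0, h1, h2, show C (4 : ℚ) = 4 from map_ofNat C 4,
    show C (2 : ℚ) = 2 from map_ofNat C 2]
  ring

theorem charpoly_cartanD_eq_mul_cofactor (m : ℕ) :
    ((cartanD (m + 3)).charpoly).map (Int.castRingHom ℚ) =
      (X - C (2 : ℚ)) * cartanDCofactor (m + 3) := by
  have hC : C (2 : ℚ) = 2 := map_ofNat C 2
  induction m using Nat.twoStepInduction with
  | zero =>
    rw [charpoly_cartanD_three, cartanDCofactor_three]
    simp [hC]
  | one =>
    rw [charpoly_cartanD_four, cartanDCofactor_add_two 2 le_rfl, cartanDCofactor_three,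
      cartanDCofactor_two]
    simp only [hC, Polynomial.map_mul, Polynomial.map_sub, Polynomial.map_add, Polynomial.map_pow,
      Polynomial.map_X, Polynomial.map_ofNat, map_ofNat]
    ring
  | more m ih₀ ih₁ =>
    rw [charpoly_cartanD_recurrence (m + 3) (by omega), cartanDCofactor_add_two (m + 3) (by omega),
      Polynomial.map_sub, Polynomial.map_mul, ih₀, ih₁]
    simp [hC]
    ring

theorem charpoly_cartanD_coeffs (n : ℕ) (hn : 3 ≤ n) :
    ((cartanD n).charpoly).map (Int.castRingHom ℚ) =
      (X - C (2 : ℚ)) *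
        ∑ j ∈ Finset.range n,
          C ((-1 : ℚ) ^ (n + j + 1) *
            ((2 * n - 2) * (Nat.factorial (n + j - 2) : ℚ)) /
              ((Nat.factorial (n - j - 1) : ℚ) * (Nat.factorial (2 * j) : ℚ))) * X ^ j := by
  obtain ⟨m, rfl⟩ := Nat.exists_eq_add_of_le' hn
  exact charpoly_cartanD_eq_mul_cofactor m
end

section
/- Let p be a monic polynomial with integer coefficients such that every complex root of p is real and lies in the closed interval [-2, 2]. Then every nonzero real root λ of p has the form λ = 2·cos(2πq) for some rational number q. -/
open Polynomial Real

lemma isIntegral_of_isIntegral_add_inv {w : ℂ} (hw : w ≠ 0) (h : IsIntegral ℤ (w + w⁻¹)) :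
    IsIntegral ℤ w := by
  let t : integralClosure ℤ ℂ := ⟨w + w⁻¹, h⟩
  refine isIntegral_trans (A := integralClosure ℤ ℂ) w ⟨X ^ 2 - C t * X + 1, by monicity!, ?_⟩
  have ht : algebraMap (integralClosure ℤ ℂ) ℂ t = w + w⁻¹ := rfl
  simp only [eval₂_add, eval₂_sub, eval₂_mul, eval₂_pow, eval₂_X, eval₂_C, eval₂_one, ht]
  field_simp
  ring

lemma norm_eq_one_of_add_inv_mem_Icc {y : ℂ} (hy : y ≠ 0) (him : (y + y⁻¹).im = 0)
    (hl : -2 ≤ (y + y⁻¹).re) (hu : (y + y⁻¹).re ≤ 2) : ‖y‖ = 1 := by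
  obtain ⟨t, ht⟩ : ∃ t : ℝ, y + y⁻¹ = t := ⟨_, Complex.ext rfl (by simpa using him)⟩
  rw [ht, Complex.ofReal_re] at hl hu
  have hq : y * y - t * y + 1 = 0 := by
    rw [← ht]
    field_simp
    ring
  have hre := congrArg Complex.re hq
  have him' := congrArg Complex.im hq
  simp at hre him'
  have hns : y.re * y.re + y.im * y.im = 1 := by
    have hprod : y.im * (2 * y.re - t) = 0 := by linarith
    rcases mul_eq_zero.mp hprod with hb | hb
    · rw [hb] at hre ⊢
      have h : y.re = t / 2 := by
        have : (y.re - t / 2) ^ 2 = 0 := by nlinarith [sq_nonneg (y.re - t / 2)]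
        linarith [pow_eq_zero_iff (two_ne_zero) |>.mp this]
      have : t = 2 * y.re := by linarith
      rw [this] at hre
      linarith
    · have : t = 2 * y.re := by linarith
      rw [this] at hre
      linarith
  rw [← Complex.normSq_apply, Complex.normSq_eq_norm_sq] at hns
  exact (pow_eq_one_iff_of_nonneg (norm_nonneg y) two_ne_zero).mp hns

open IntermediateField in
lemma exists_pow_eq_one_of_aeval_add_inv {p : ℤ[X]} (hp : p.Monic)
    (hroots : ∀ z : ℂ, aeval z p = 0 → z.im = 0 ∧ -2 ≤ z.re ∧ z.re ≤ 2)
    {w : ℂ} (hw : w ≠ 0) (hroot : aeval (w + w⁻¹) p = 0) :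
    ∃ n : ℕ, 0 < n ∧ w ^ n = 1 := by
  have hint : IsIntegral ℤ w := isIntegral_of_isIntegral_add_inv hw ⟨p, hp, hroot⟩
  have : FiniteDimensional ℚ ℚ⟮w⟯ := adjoin.finiteDimensional hint.tower_top
  have : NumberField ℚ⟮w⟯ := ⟨⟩
  let ι : ℚ⟮w⟯ →+* ℂ := algebraMap ℚ⟮w⟯ ℂ
  let x : ℚ⟮w⟯ := AdjoinSimple.gen ℚ w
  have hιx : ι x = w := AdjoinSimple.algebraMap_gen ℚ w
  have hx0 : x ≠ 0 := fun h => hw (by rw [← hιx, h, map_zero])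
  have hxint : IsIntegral ℤ x :=
    (isIntegral_algHom_iff ι.toIntAlgHom ι.injective).mp (by simpa [hιx] using hint)
  have hxroot : aeval (x + x⁻¹) p = 0 := by
    apply ι.injective
    have := aeval_algHom_apply ι.toIntAlgHom (x + x⁻¹) p
    simp only [RingHom.toIntAlgHom_apply, map_add, map_inv₀, hιx] at this
    rw [← this, map_zero, hroot]
  obtain ⟨n, hn, h⟩ := NumberField.Embeddings.pow_eq_one_of_norm_eq_one ℚ⟮w⟯ ℂ hxint fun φ => by
    have h := aeval_algHom_apply φ.toIntAlgHom (x + x⁻¹) p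
    simp only [RingHom.toIntAlgHom_apply, map_add, map_inv₀, hxroot, map_zero] at h
    obtain ⟨him, hl, hu⟩ := hroots _ h
    exact norm_eq_one_of_add_inv_mem_Icc (by simpa using hx0) him hl hu
  exact ⟨n, hn, by rw [← hιx, ← map_pow, h, map_one]⟩

theorem root_in_Icc_is_two_cos_rat (p : ℤ[X]) (hp : p.Monic)
    (hroots : ∀ z : ℂ, aeval z p = 0 → z.im = 0 ∧ -2 ≤ z.re ∧ z.re ≤ 2)
    (lam : ℝ) (hlam : lam ≠ 0) (hroot : aeval lam p = 0) :
    ∃ q : ℚ, lam = 2 * Real.cos (2 * Real.pi * q) := by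
  have hrootC : aeval (lam : ℂ) p = 0 := by
    have := aeval_algebraMap_apply ℂ lam p
    rwa [hroot, map_zero] at this
  obtain ⟨-, hl, hu⟩ := hroots _ hrootC
  rw [Complex.ofReal_re] at hl hu
  set θ := Real.arccos (lam / 2) with hθ
  have hcos : 2 * Real.cos θ = lam := by
    rw [hθ, Real.cos_arccos (by linarith) (by linarith)]
    ring
  have hw : Complex.exp (θ * Complex.I) + (Complex.exp (θ * Complex.I))⁻¹ = lam := by
    rw [← Complex.exp_neg, ← neg_mul, ← Complex.two_cos, ← hcos]
    push_cast
    rfl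
  obtain ⟨n, hn, h⟩ := exists_pow_eq_one_of_aeval_add_inv hp hroots
    (Complex.exp_ne_zero (θ * Complex.I)) (by rw [hw, hrootC])
  rw [← Complex.exp_nat_mul, Complex.exp_eq_one_iff] at h
  obtain ⟨k, hk⟩ := h
  have hnθ : n * θ = k * (2 * Real.pi) := by
    have := congrArg Complex.im hk
    simpa using this
  have hn0 : (n : ℝ) ≠ 0 := by exact_mod_cast hn.ne'
  refine ⟨k / n, ?_⟩
  rw [← hcos]
  congr 2
  push_cast
  field_simp
  linarith
end

section
/- Let n ≥ 2 be an integer, write n - 1 = 2^α · N with N odd, and set r = 2^{α+1}. Then the following identity of polynomials over ℤ holds: X^{2n} + X^{2n-2} + X^2 + 1 = Φ_4(X) · ∏_{d ∣ N} Φ_{2r·d}(X), where the product runs over all positive divisors d of N and Φ_m denotes the m-th cyclotomic polynomial. -/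
open Polynomial

theorem Nat.divisors_two_pow_succ_mul (k : ℕ) {N : ℕ} (hN : Odd N) :
    (2 ^ (k + 1) * N).divisors =
      (2 ^ k * N).divisors ∪ N.divisors.image (2 ^ (k + 1) * ·) := by
  have hN0 : N ≠ 0 := hN.pos.ne'
  ext d
  simp only [Finset.mem_union, Finset.mem_image, Nat.mem_divisors]
  constructor
  · rintro ⟨hd, -⟩
    obtain ⟨a, b, ha, hb, rfl⟩ := (Nat.dvd_mul).1 hd
    obtain ⟨j, hj, rfl⟩ := (Nat.dvd_prime_pow Nat.prime_two).1 ha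
    rcases hj.eq_or_lt with rfl | hlt
    · exact Or.inr ⟨b, ⟨hb, hN0⟩, rfl⟩
    · exact Or.inl ⟨mul_dvd_mul (pow_dvd_pow 2 (Nat.lt_succ_iff.1 hlt)) hb, by positivity⟩
  · rintro (⟨hd, -⟩ | ⟨b, ⟨hb, -⟩, rfl⟩)
    · exact ⟨hd.trans (mul_dvd_mul_right (pow_dvd_pow 2 k.le_succ) N), by positivity⟩
    · exact ⟨mul_dvd_mul_left _ hb, by positivity⟩

theorem Nat.disjoint_divisors_two_pow_mul_image (k : ℕ) {N : ℕ} (hN : Odd N) :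
    Disjoint (2 ^ k * N).divisors (N.divisors.image (2 ^ (k + 1) * ·)) := by
  rw [Finset.disjoint_left]
  intro d hd hd'
  obtain ⟨b, -, rfl⟩ := Finset.mem_image.1 hd'
  have h : 2 ^ k * (2 * b) ∣ 2 ^ k * N := by
    simpa only [pow_succ, mul_assoc] using Nat.dvd_of_mem_divisors hd
  have h2 : 2 ∣ N := (dvd_mul_right 2 b).trans (Nat.dvd_of_mul_dvd_mul_left (by positivity) h)
  exact Nat.not_even_iff_odd.2 hN (even_iff_two_dvd.2 h2)

theorem Polynomial.prod_cyclotomic_two_pow_succ_mul (k : ℕ) {N : ℕ} (hN : Odd N) :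
    ∏ d ∈ N.divisors, cyclotomic (2 ^ (k + 1) * d) ℤ = X ^ (2 ^ k * N) + 1 := by
  have hpos : 0 < 2 ^ k * N := Nat.mul_pos (by positivity) hN.pos
  have hpos' : 0 < 2 ^ (k + 1) * N := Nat.mul_pos (by positivity) hN.pos
  have h := prod_cyclotomic_eq_X_pow_sub_one hpos' ℤ
  rw [Nat.divisors_two_pow_succ_mul k hN,
    Finset.prod_union (Nat.disjoint_divisors_two_pow_mul_image k hN),
    prod_cyclotomic_eq_X_pow_sub_one hpos,
    Finset.prod_image fun a _ b _ hab => Nat.eq_of_mul_eq_mul_left (by positivity) hab] at h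
  refine mul_left_cancel₀ (X_pow_sub_C_ne_zero hpos (1 : ℤ)) ?_
  rw [C_1, h]
  ring

theorem Polynomial.cyclotomic_four_int : cyclotomic 4 ℤ = X ^ 2 + 1 := by
  simpa using prod_cyclotomic_two_pow_succ_mul 1 odd_one

theorem assoc_poly_Dn_cyclotomic_factorization (n : ℕ) (hn : 2 ≤ n)
    (α N : ℕ) (hN : Odd N) (hnfact : n - 1 = 2 ^ α * N) (r : ℕ) (hr : r = 2 ^ (α + 1)) :
    (X : ℤ[X]) ^ (2 * n) + X ^ (2 * n - 2) + X ^ 2 + 1 =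
      cyclotomic 4 ℤ * ∏ d ∈ N.divisors, cyclotomic (2 * r * d) ℤ := by
  have hr2 : 2 * r = 2 ^ (α + 1 + 1) := by rw [hr, pow_succ' 2 (α + 1)]
  have hm : 2 ^ (α + 1) * N = 2 * n - 2 := by rw [pow_succ', mul_assoc, ← hnfact]; omega
  rw [hr2, prod_cyclotomic_two_pow_succ_mul (α + 1) hN, cyclotomic_four_int, hm,
    show 2 * n = 2 * n - 2 + 2 by omega, Nat.add_sub_cancel]
  ring
end

section
/- Let n be a positive integer. For each integer j ≥ 3 let ψ_j denote the minimal polynomial over ℚ of 2·cos(2π/j). Then the n-th Chebyshev polynomial of the second kind satisfies, as polynomials over ℚ, U_n(X) = ∏_{j} ψ_j(2X), where the product runs over all divisors j of 2n+2 with j ∉ {1, 2}, and ψ_j(2X) denotes the composition of ψ_j with the polynomial 2X. -/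
open Polynomial Real

theorem Polynomial.Chebyshev.natDegree_S_natCast {R : Type*} [CommRing R] [IsDomain R]
    [NeZero (2 : R)] (n : ℕ) : (Chebyshev.S R n).natDegree = n := by
  have h := congrArg natDegree (Chebyshev.S_comp_two_mul_X R n)
  have hX : (2 * X : R[X]).natDegree = 1 := by
    rw [← C_ofNat, natDegree_C_mul_X _ two_ne_zero]
  rwa [natDegree_comp, hX, mul_one, Chebyshev.natDegree_U_natCast] at h

theorem Polynomial.Chebyshev.monic_S_natCast {R : Type*} [CommRing R] [IsDomain R]
    [NeZero (2 : R)] (n : ℕ) : (Chebyshev.S R n).Monic := by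
  have h := congrArg leadingCoeff (Chebyshev.S_comp_two_mul_X R n)
  have hX : (2 * X : R[X]) = Polynomial.C 2 * X := by rw [C_ofNat]
  rw [hX, leadingCoeff_comp (by rw [natDegree_C_mul_X _ two_ne_zero]; exact one_ne_zero),
    leadingCoeff_C_mul_X, Chebyshev.leadingCoeff_U_natCast,
    Chebyshev.natDegree_S_natCast] at h
  exact mul_right_cancel₀ (pow_ne_zero n two_ne_zero) (h.trans (one_mul _).symm)

theorem aeval_two_mul_cos_eq_zero_of_coprime {P : ℚ[X]} {j a : ℕ} (hj : j ≠ 0)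
    (ha : a.Coprime j) (hP : aeval (2 * Real.cos (2 * Real.pi / j)) P = 0) :
    aeval (2 * Real.cos (2 * Real.pi * (a / j))) P = 0 := by
  have key : ∀ b : ℕ, (((2 * Real.cos (2 * Real.pi * (b / j)) : ℝ) : ℂ)) =
      aeval (Complex.exp (2 * Real.pi * Complex.I * (b / j))) (X + X ^ (j - 1) : ℚ[X]) := by
    intro b
    have hinv : Complex.exp (2 * Real.pi * Complex.I * (b / j)) ^ (j - 1) =
        Complex.exp (-(2 * Real.pi * Complex.I * (b / j))) := by
      rw [← Complex.exp_nat_mul, Complex.exp_eq_exp_iff_exists_int]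
      refine ⟨b, ?_⟩
      rw [Nat.cast_sub (Nat.one_le_iff_ne_zero.mpr hj)]
      have : (j : ℂ) ≠ 0 := mod_cast hj
      push_cast
      field_simp
      ring
    rw [map_add, map_pow, aeval_X, hinv]
    push_cast
    rw [Complex.two_cos]
    ring_nf
  have transfer : ∀ b : ℕ, aeval (2 * Real.cos (2 * Real.pi * (b / j))) P = 0 ↔
      aeval (Complex.exp (2 * Real.pi * Complex.I * (b / j)))
        (P.comp (X + X ^ (j - 1))) = 0 := by
    intro b
    rw [aeval_comp, ← key b, ← Complex.coe_algebraMap, aeval_algebraMap_eq_zero_iff]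
  have hroot : aeval (Complex.exp (2 * Real.pi * Complex.I * ((1 : ℕ) / j)))
      (P.comp (X + X ^ (j - 1))) = 0 := by
    rw [← transfer, Nat.cast_one, mul_one_div]
    exact hP
  have hpos := Nat.pos_of_ne_zero hj
  rw [transfer, ← minpoly.dvd_iff, ← cyclotomic_eq_minpoly_rat
    (Complex.isPrimitiveRoot_exp_of_coprime a j hj ha) hpos, cyclotomic_eq_minpoly_rat
    (Complex.isPrimitiveRoot_exp_of_coprime 1 j hj j.coprime_one_left) hpos, minpoly.dvd_iff]
  exact hroot

theorem isIntegral_two_mul_cos_two_pi_div (j : ℕ) :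
    IsIntegral ℚ (2 * Real.cos (2 * Real.pi / j)) := by
  have h := (isIntegral_two_mul_cos_rat_mul_pi (2 / j)).tower_top (A := ℚ)
  push_cast at h
  rwa [div_mul_eq_mul_div] at h

theorem dvd_of_minpoly_two_mul_cos_eq {j k : ℕ} (hj : j ≠ 0) (hk : k ≠ 0)
    (h : minpoly ℚ (2 * Real.cos (2 * Real.pi / j)) =
      minpoly ℚ (2 * Real.cos (2 * Real.pi / k))) : k ∣ j := by
  have hroot : aeval (2 * Real.cos (2 * Real.pi / j)) (Chebyshev.C ℚ j - C 2) = 0 := by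
    have : (j : ℝ) * (2 * Real.pi / j) = 2 * Real.pi := by field_simp
    simp [Chebyshev.aeval_C, this]
  rw [← minpoly.dvd_iff, h, minpoly.dvd_iff] at hroot
  have hcos : Real.cos (j * (2 * Real.pi / k)) = 1 := by
    simp [Chebyshev.aeval_C] at hroot
    linarith
  obtain ⟨m, hm⟩ := (Real.cos_eq_one_iff _).mp hcos
  have hpi := Real.pi_ne_zero
  field_simp at hm
  exact Int.natCast_dvd_natCast.mp ⟨m, by rw [mul_comm]; exact_mod_cast hm.symm⟩

theorem minpoly_two_mul_cos_dvd_S {n j : ℕ} (hj : j ∣ 2 * n + 2) (hj3 : 3 ≤ j) :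
    minpoly ℚ (2 * Real.cos (2 * Real.pi / j)) ∣ Chebyshev.S ℚ n := by
  have hj0 : (0 : ℝ) < j := by positivity
  have hsin : Real.sin (2 * Real.pi / j) ≠ 0 := by
    refine (Real.sin_pos_of_pos_of_lt_pi (by positivity) ?_).ne'
    rw [div_lt_iff₀ hj0, mul_comm]
    have : (3 : ℝ) ≤ j := mod_cast hj3
    nlinarith [Real.pi_pos]
  rw [minpoly.dvd_iff, Chebyshev.aeval_S]
  refine (mul_eq_zero_iff_right hsin).mp ?_
  rw [Chebyshev.S_two_mul_real_cos, Real.sin_eq_zero_iff]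
  obtain ⟨d, hd⟩ := hj
  have hd' : (2 * n + 2 : ℝ) = j * d := mod_cast hd
  refine ⟨d, ?_⟩
  push_cast
  field_simp
  linarith

theorem S_eq_prod_minpoly_two_mul_cos (n : ℕ) :
    Chebyshev.S ℚ n = ∏ j ∈ (2 * n + 2).divisors \ {1, 2},
      minpoly ℚ (2 * Real.cos (2 * Real.pi / j)) := by
  have hmem : ∀ j ∈ (2 * n + 2).divisors \ {1, 2}, j ∣ 2 * n + 2 ∧ 3 ≤ j := by
    intro j hj
    simp only [Finset.mem_sdiff, Nat.mem_divisors, Finset.mem_insert,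
      Finset.mem_singleton] at hj
    have := Nat.pos_of_dvd_of_pos hj.1.1 (by omega)
    omega
  have hψ : ∀ j : ℕ, (minpoly ℚ (2 * Real.cos (2 * Real.pi / j))).Monic := fun j ↦
    minpoly.monic (isIntegral_two_mul_cos_two_pi_div j)
  have hirr : ∀ j : ℕ, Irreducible (minpoly ℚ (2 * Real.cos (2 * Real.pi / j))) := fun j ↦
    minpoly.irreducible (isIntegral_two_mul_cos_two_pi_div j)
  have hmonic := monic_prod_of_monic ((2 * n + 2).divisors \ {1, 2}) _ fun j _ ↦ hψ j
  have hdvd : ∏ j ∈ (2 * n + 2).divisors \ {1, 2},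
      minpoly ℚ (2 * Real.cos (2 * Real.pi / j)) ∣ Chebyshev.S ℚ n := by
    refine Finset.prod_dvd_of_isRelPrime (fun j hj k hk hjk ↦ ?_) fun j hj ↦
      minpoly_two_mul_cos_dvd_S (hmem j hj).1 (hmem j hj).2
    have hj3 := (hmem j hj).2
    have hk3 := (hmem k hk).2
    refine (hirr j).isRelPrime_iff_not_dvd.mpr fun h ↦ hjk ?_
    have heq := eq_of_monic_of_associated (hψ j) (hψ k)
      ((hirr j).associated_of_dvd (hirr k) h)
    exact Nat.dvd_antisymm (dvd_of_minpoly_two_mul_cos_eq (by omega) (by omega) heq.symm)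
      (dvd_of_minpoly_two_mul_cos_eq (by omega) (by omega) heq)
  refine eq_of_monic_of_dvd_of_natDegree_le hmonic (Chebyshev.monic_S_natCast n) hdvd ?_
  rw [Chebyshev.natDegree_S_natCast]
  set P := ∏ j ∈ (2 * n + 2).divisors \ {1, 2},
      minpoly ℚ (2 * Real.cos (2 * Real.pi / j))
  let Z : Finset ℝ :=
    (Finset.range n).image fun k : ℕ ↦ 2 * Real.cos ((k + 1) * Real.pi / (n + 1))
  have hZcard : Z.card = n := by
    refine (Finset.card_image_of_injOn fun x hx y hy hxy ↦ ?_).trans (Finset.card_range n)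
    exact (Finset.range n).nodup_map_iff_injOn.mp (Chebyshev.roots_U_real_nodup n) hx hy
      (mul_left_cancel₀ two_ne_zero hxy)
  have hZ : Z.val ⊆ (P.map (algebraMap ℚ ℝ)).roots := by
    intro x hx
    obtain ⟨k, hk, rfl⟩ := Finset.mem_image.mp (Finset.mem_val.mp hx)
    rw [Finset.mem_range] at hk
    rw [mem_roots_map hmonic.ne_zero, ← aeval_def]
    obtain ⟨g, a, j, hg, hcop, ha, hj⟩ :=
      Nat.exists_coprime' (Nat.gcd_pos_of_pos_left (2 * n + 2) k.succ_pos)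
    have ha0 : a ≠ 0 := by rintro rfl; omega
    have hj0 : j ≠ 0 := by rintro rfl; omega
    have hga : g ≤ a * g := Nat.le_mul_of_pos_left g (Nat.pos_of_ne_zero ha0)
    have hjmem : j ∈ (2 * n + 2).divisors \ {1, 2} := by
      simp only [Finset.mem_sdiff, Nat.mem_divisors, Finset.mem_insert, Finset.mem_singleton]
      refine ⟨⟨⟨g, hj⟩, by omega⟩, ?_⟩
      rintro (rfl | rfl) <;> omega
    have hangle : (k + 1) * Real.pi / (n + 1) = 2 * Real.pi * (a / j) := by
      have ha' : (k + 1 : ℝ) = a * g := mod_cast ha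
      have hj' : (2 * n + 2 : ℝ) = j * g := mod_cast hj
      have hjR : (j : ℝ) ≠ 0 := mod_cast hj0
      have hnR : (n + 1 : ℝ) ≠ 0 := by positivity
      field_simp
      linear_combination (j : ℝ) * ha' - (a : ℝ) * hj'
    rw [hangle]
    exact aeval_eq_zero_of_dvd_aeval_eq_zero (Finset.dvd_prod_of_mem _ hjmem)
      (aeval_two_mul_cos_eq_zero_of_coprime hj0 hcop (minpoly.aeval _ _))
  calc n = Z.card := hZcard.symm
    _ ≤ (P.map (algebraMap ℚ ℝ)).natDegree := card_le_degree_of_subset_roots hZ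
    _ = P.natDegree := natDegree_map _

theorem chebyshevU_factorization (n : ℕ) (hn : 0 < n) :
    Polynomial.Chebyshev.U ℚ (n : ℤ) =
      ∏ j ∈ (2 * n + 2).divisors \ {1, 2},
        (minpoly ℚ (2 * Real.cos (2 * Real.pi / j))).comp (2 * X) := by
  rw [← Chebyshev.S_comp_two_mul_X, S_eq_prod_minpoly_two_mul_cos, prod_comp]
end
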